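/- Let p ≥ 1, k ≥ 1, and let α_1, ..., α_{k+1} and δ be complex numbers with Re(α_j) > p-1 for j = 1, ..., k+1 and Re(α_{k+1} + δ) > p-1. Let f₁ be the complex matrix-variate type-1 Dirichlet density f₁(X_1,...,X_k) = D̃_k ∏_{j=1}^k det(X_j)^{α_j - p} · det(I - X_1 - ... - X_k)^{α_{k+1} - p}, with D̃_k = Γ̃_p(α_1 + ... + α_{k+1}) / ∏_{j=1}^{k+1} Γ̃_p(α_j), supported on tuples of positive definite p×p self-adjoint matrices with I - X_1 - ... - X_k positive definite. Then the Dirichlet average of φ₂(X_1,...,X_k) = det(I - X_1 - ... - X_k)^{δ} with respect to f₁ equals ( Γ̃_p(α_{k+1} + δ)/Γ̃_p(α_{k+1}) ) · Γ̃_p(α_1 + ... + α_{k+1}) / Γ̃_p(α_1 + ... + α_{k+1} + δ). -/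

import Mathlib

open MeasureTheory Matrix
open scoped ComplexOrder

noncomputable section

/-- Parameter space `ℝ^p × ℂ^{p(p-1)/2}` for `p × p` Hermitian matrices:
the real diagonal entries together with the strictly upper-triangular complex entries. -/
abbrev HermParam (p : ℕ) : Type :=
  (Fin p → ℝ) × ({ q : Fin p × Fin p // q.1 < q.2 } → ℂ)

/-- The linear isomorphism sending the parameters to the corresponding self-adjoint matrix. -/
def toHermMatrix (p : ℕ) (T : HermParam p) : Matrix (Fin p) (Fin p) ℂ :=
  Matrix.of fun i j =>
    if h : i < j then T.2 ⟨(i, j), h⟩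
    else if h' : j < i then (starRingEnd ℂ) (T.2 ⟨(j, i), h'⟩)
    else (T.1 i : ℂ)

noncomputable instance matrixComplexMeasureSpace (m n : ℕ) :
    MeasureSpace (Matrix (Fin m) (Fin n) ℂ) :=
  inferInstanceAs (MeasureSpace (Fin m → Fin n → ℂ))

/-- The Lebesgue measure `μ_p` on Herm(p), realized as a measure on the space of
`p × p` complex matrices: the pushforward of Lebesgue measure on the parameter space
under the linear isomorphism `toHermMatrix p`. -/
def hermLebesgue (p : ℕ) : Measure (Matrix (Fin p) (Fin p) ℂ) :=
  Measure.map (toHermMatrix p) volume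

/-- The complex matrix-variate gamma function
`Γ̃_p(α) = π^{p(p-1)/2} ∏_{j=1}^p Γ(α - j + 1) = π^{p(p-1)/2} ∏_{j=0}^{p-1} Γ(α - j)`. -/
def cGammaP (p : ℕ) (α : ℂ) : ℂ :=
  (Real.pi : ℂ) ^ (p * (p - 1) / 2) * ∏ j : Fin p, Complex.Gamma (α - j)

end

section

open Set

lemma toHermMatrix_add (p : ℕ) (S T : HermParam p) :
    toHermMatrix p (S + T) = toHermMatrix p S + toHermMatrix p T := by
  ext i j
  simp only [toHermMatrix, of_apply, Matrix.add_apply]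
  split_ifs <;> simp

lemma toHermMatrix_smul (p : ℕ) (c : ℝ) (T : HermParam p) :
    toHermMatrix p (c • T) = c • toHermMatrix p T := by
  ext i j
  simp only [toHermMatrix, of_apply, Matrix.smul_apply]
  split_ifs <;> simp

/-- `toHermMatrix` as a linear map. -/
def hermLinear (p : ℕ) : HermParam p →ₗ[ℝ] Matrix (Fin p) (Fin p) ℂ where
  toFun := toHermMatrix p
  map_add' := toHermMatrix_add p
  map_smul' := toHermMatrix_smul p

lemma toHermMatrix_sub (p : ℕ) (S T : HermParam p) :
    toHermMatrix p (S - T) = toHermMatrix p S - toHermMatrix p T :=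
  map_sub (hermLinear p) S T

lemma toHermMatrix_sum (p : ℕ) {ι : Type*} (s : Finset ι) (T : ι → HermParam p) :
    toHermMatrix p (∑ i ∈ s, T i) = ∑ i ∈ s, toHermMatrix p (T i) :=
  map_sum (hermLinear p) T s

lemma isHermitian_toHermMatrix (p : ℕ) (T : HermParam p) : (toHermMatrix p T).IsHermitian := by
  ext i j
  simp only [toHermMatrix, of_apply, conjTranspose_apply]
  rcases lt_trichotomy i j with h | h | h
  · simp [h, h.not_gt]
  · subst h; simp
  · simp [h, h.not_gt]

/-- The parameters of a self-adjoint matrix. -/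
def hermParam {p : ℕ} (M : Matrix (Fin p) (Fin p) ℂ) : HermParam p :=
  (fun i => (M i i).re, fun q => M q.1.1 q.1.2)

lemma hermParam_toHermMatrix (p : ℕ) (T : HermParam p) : hermParam (toHermMatrix p T) = T := by
  refine Prod.ext ?_ ?_
  · ext i; simp [hermParam, toHermMatrix]
  · ext q; simp [hermParam, toHermMatrix, q.2]

lemma toHermMatrix_hermParam {p : ℕ} {M : Matrix (Fin p) (Fin p) ℂ} (hM : M.IsHermitian) :
    toHermMatrix p (hermParam M) = M := by
  ext i j
  simp only [toHermMatrix, of_apply, hermParam]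
  split_ifs with h h'
  · rfl
  · exact hM.apply i j
  · obtain rfl : i = j := le_antisymm (not_lt.1 h') (not_lt.1 h)
    exact Complex.conj_eq_iff_re.1 (hM.apply i i)

lemma continuous_toHermMatrix (p : ℕ) : Continuous (toHermMatrix p) :=
  (hermLinear p).continuous_of_finiteDimensional

lemma toHermMatrix_injective (p : ℕ) : Function.Injective (toHermMatrix p) :=
  Function.LeftInverse.injective (hermParam_toHermMatrix p)

instance (m n : ℕ) : BorelSpace (Matrix (Fin m) (Fin n) ℂ) :=
  inferInstanceAs (BorelSpace (Fin m → Fin n → ℂ))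

lemma measurableEmbedding_toHermMatrix (p : ℕ) : MeasurableEmbedding (toHermMatrix p) :=
  (LinearMap.isClosedEmbedding_of_injective (f := hermLinear p)
    (LinearMap.ker_eq_bot.2 (toHermMatrix_injective p))).measurableEmbedding

/-- The congruence action `X ↦ A X Aᴴ` on self-adjoint matrices, in parameter space. -/
def congrHerm {p : ℕ} (A : Matrix (Fin p) (Fin p) ℂ) : HermParam p →ₗ[ℝ] HermParam p where
  toFun T := hermParam (A * toHermMatrix p T * Aᴴ)
  map_add' S T := by
    rw [toHermMatrix_add, mul_add, add_mul]
    refine Prod.ext ?_ ?_ <;> ext <;> simp [hermParam]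
  map_smul' c T := by
    rw [toHermMatrix_smul, mul_smul_comm, smul_mul_assoc]
    refine Prod.ext ?_ ?_ <;> ext <;> simp [hermParam]

lemma toHermMatrix_congrHerm {p : ℕ} (A : Matrix (Fin p) (Fin p) ℂ) (T : HermParam p) :
    toHermMatrix p (congrHerm A T) = A * toHermMatrix p T * Aᴴ :=
  toHermMatrix_hermParam
    (isHermitian_mul_mul_conjTranspose A (isHermitian_toHermMatrix p T))

lemma congrHerm_mul {p : ℕ} (A B : Matrix (Fin p) (Fin p) ℂ) :
    congrHerm (A * B) = congrHerm A ∘ₗ congrHerm B := by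
  ext1 <;> ext1 <;> ext1 <;> apply toHermMatrix_injective p <;>
  simp [toHermMatrix_congrHerm, conjTranspose_mul, mul_assoc]

lemma congrHerm_one (p : ℕ) : congrHerm (1 : Matrix (Fin p) (Fin p) ℂ) = LinearMap.id := by
  refine LinearMap.ext fun T => toHermMatrix_injective p ?_
  simp [toHermMatrix_congrHerm]

/-- Strictly increasing pairs in `Fin (p + 1)`, split according to whether the first entry is
`0`. -/
noncomputable def increasingPairsSucc (p : ℕ) :
    Fin p ⊕ { q : Fin p × Fin p // q.1 < q.2 } ≃
      { q : Fin (p + 1) × Fin (p + 1) // q.1 < q.2 } :=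
  Equiv.ofBijective
    (Sum.elim (fun j => ⟨(0, j.succ), j.succ_pos⟩)
      fun q => ⟨(q.1.1.succ, q.1.2.succ), Fin.succ_lt_succ_iff.2 q.2⟩) <| by
    constructor
    · rintro (j | ⟨⟨a, b⟩, h⟩) (j' | ⟨⟨a', b'⟩, h'⟩) <;>
        simp [(Fin.succ_ne_zero _).symm]
    · rintro ⟨⟨a, b⟩, h⟩
      obtain ⟨b, rfl⟩ := Fin.exists_succ_eq.2 (ne_of_gt (lt_of_le_of_lt (Fin.zero_le a) h))
      rcases Fin.eq_zero_or_eq_succ a with rfl | ⟨a, rfl⟩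
      · exact ⟨Sum.inl b, rfl⟩
      · exact ⟨Sum.inr ⟨(a, b), Fin.succ_lt_succ_iff.1 h⟩, rfl⟩

lemma increasingPairsSucc_inl {p : ℕ} (j : Fin p) :
    (increasingPairsSucc p (Sum.inl j)).1 = (0, j.succ) := rfl

lemma increasingPairsSucc_inr {p : ℕ} (q : { q : Fin p × Fin p // q.1 < q.2 }) :
    (increasingPairsSucc p (Sum.inr q)).1 = (q.1.1.succ, q.1.2.succ) := rfl

lemma prod_increasingPairs_mul_prod {p : ℕ} (d : Fin p → ℝ) :
    (∏ q : { q : Fin p × Fin p // q.1 < q.2 }, (d q.1.1 * d q.1.2) ^ 2) * (∏ i, d i ^ 2)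
      = ((∏ i, d i) ^ 2) ^ p := by
  induction p with
  | zero => simp
  | succ p ih =>
    rw [← (increasingPairsSucc p).prod_comp]
    simp only [Fintype.prod_sum_type, Fin.prod_univ_succ (n := p)]
    have h := ih fun i => d i.succ
    simp only [increasingPairsSucc_inl, increasingPairsSucc_inr, mul_pow,
      Finset.prod_mul_distrib, Finset.prod_const, Finset.card_univ, Fintype.card_fin,
      Finset.prod_pow] at h ⊢
    linear_combination (d 0 ^ 2) ^ (p + 1) * (∏ i : Fin p, d i.succ) ^ 2 * h

lemma det_congrHerm_diagonal {p : ℕ} (d : Fin p → ℝ) :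
    LinearMap.det (congrHerm (diagonal fun i => (d i : ℂ))) = ((∏ i, d i) ^ 2) ^ p := by
  have h : congrHerm (diagonal fun i => (d i : ℂ)) =
      (LinearMap.pi fun i => (d i ^ 2) • LinearMap.proj i).prodMap
        (LinearMap.pi fun q => ((d q.1.1 * d q.1.2) • LinearMap.proj q)) := by
    refine LinearMap.ext fun T => ?_
    refine Prod.ext ?_ ?_
    · ext i
      simp [congrHerm, hermParam, toHermMatrix, diagonal_conjTranspose]
      ring
    · ext q
      simp [congrHerm, hermParam, toHermMatrix, diagonal_conjTranspose, q.2]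
      ring
  rw [h, LinearMap.det_prodMap]
  have h1 := LinearMap.det_pi (R := ℝ) (M := ℝ) fun i => (d i ^ 2) • LinearMap.id
  have h2 := LinearMap.det_pi (R := ℝ) (M := ℂ)
    fun q : { q : Fin p × Fin p // q.1 < q.2 } => (d q.1.1 * d q.1.2) • LinearMap.id
  simp only [LinearMap.det_smul, LinearMap.det_id, Module.finrank_self,
    Complex.finrank_real_complex, mul_one, pow_one] at h1 h2
  rw [← prod_increasingPairs_mul_prod, ← h1, ← h2, mul_comm]
  rfl

lemma exists_congr_factor {p : ℕ} {Y : Matrix (Fin p) (Fin p) ℂ} (hY : Y.PosDef) :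
    ∃ A : Matrix (Fin p) (Fin p) ℂ, IsUnit A ∧ A * Aᴴ = Y ∧
      LinearMap.det (congrHerm A) = Y.det.re ^ p := by
  set U : Matrix (Fin p) (Fin p) ℂ := hY.1.eigenvectorUnitary.val
  have hU : U * Uᴴ = 1 := Unitary.coe_mul_star_self _
  have hU' : Uᴴ * U = 1 := Unitary.coe_star_mul_self _
  set s : Fin p → ℝ := fun i => √(hY.1.eigenvalues i)
  set D : Matrix (Fin p) (Fin p) ℂ := diagonal fun i => (s i : ℂ)
  have hs : ∀ i, (s i : ℂ) * s i = hY.1.eigenvalues i := fun i => by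
    rw [← Complex.ofReal_mul, Real.mul_self_sqrt (hY.eigenvalues_pos i).le]
  have hDD : D * D = diagonal fun i => (hY.1.eigenvalues i : ℂ) := by
    simp [D, diagonal_mul_diagonal, hs]
  have hD : Dᴴ = D := by
    simp [D, diagonal_conjTranspose]
  have hA : (U * D * Uᴴ) * (U * D * Uᴴ)ᴴ = Y := by
    have : (U * D * Uᴴ) * (U * D * Uᴴ)ᴴ = U * (D * D) * Uᴴ := by
      simp only [conjTranspose_mul, conjTranspose_conjTranspose, hD]
      calc _ = U * D * (Uᴴ * U) * D * Uᴴ := by simp only [mul_assoc]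
        _ = _ := by rw [hU']; simp only [mul_assoc, mul_one]
    rw [this, hDD]
    conv_rhs => rw [hY.1.spectral_theorem]
    rfl
  refine ⟨U * D * Uᴴ, ?_, hA, ?_⟩
  · have : IsUnit ((U * D * Uᴴ) * (U * D * Uᴴ)ᴴ).det := by
      rw [hA]; exact (isUnit_iff_isUnit_det _).1 hY.isUnit
    rw [det_mul] at this
    exact (isUnit_iff_isUnit_det _).2 (isUnit_of_mul_isUnit_left this)
  · rw [congrHerm_mul, congrHerm_mul, LinearMap.det_comp, LinearMap.det_comp, mul_right_comm,
      ← LinearMap.det_comp, ← congrHerm_mul, hU, congrHerm_one, LinearMap.det_id, one_mul,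
      det_congrHerm_diagonal, hY.1.det_eq_prod_eigenvalues]
    congr 1
    rw [← Finset.prod_pow]
    have : ∀ i, s i ^ 2 = hY.1.eigenvalues i := fun i => Real.sq_sqrt (hY.eigenvalues_pos i).le
    simp only [this]
    norm_cast

lemma isClosed_setOf_posSemidef (p : ℕ) :
    IsClosed {M : Matrix (Fin p) (Fin p) ℂ | M.PosSemidef} := by
  simp only [posSemidef_iff_dotProduct_mulVec, ofPred_and, ofPred_forall]
  refine IsClosed.inter (isClosed_eq continuous_id.matrix_conjTranspose continuous_id) ?_
  refine isClosed_iInter fun x => isClosed_le continuous_const ?_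
  fun_prop

lemma measurableSet_setOf_posDef (p : ℕ) :
    MeasurableSet {M : Matrix (Fin p) (Fin p) ℂ | M.PosDef} := by
  have : {M : Matrix (Fin p) (Fin p) ℂ | M.PosDef} =
      {M | M.PosSemidef} ∩ {M | M.det ≠ 0} := by
    ext M
    exact ⟨fun h => ⟨h.posSemidef, h.posSemidef.posDef_iff_det_ne_zero.1 h⟩,
      fun h => h.1.posDef_iff_det_ne_zero.2 h.2⟩
  rw [this]
  exact (isClosed_setOf_posSemidef p).measurableSet.inter
    (isOpen_ne_fun (by fun_prop) continuous_const).measurableSet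

/-- The cone of positive definite matrices, in parameter space. -/
def posCone (p : ℕ) : Set (HermParam p) := {T | (toHermMatrix p T).PosDef}

lemma measurableSet_posCone (p : ℕ) : MeasurableSet (posCone p) :=
  (continuous_toHermMatrix p).measurable (measurableSet_setOf_posDef p)

/-- The determinant of a self-adjoint matrix, as a function of its parameters. -/
def detHerm (p : ℕ) (T : HermParam p) : ℝ := (toHermMatrix p T).det.re

lemma measurable_detHerm (p : ℕ) : Measurable (detHerm p) :=
  (Complex.continuous_re.comp (continuous_toHermMatrix p).matrix_det).measurable

lemma detHerm_pos {p : ℕ} {T : HermParam p} (hT : T ∈ posCone p) : 0 < detHerm p T :=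
  (Complex.pos_iff.1 (PosDef.det_pos hT)).1

/-- The trace of a self-adjoint matrix, as a function of its parameters. -/
def traceHerm (p : ℕ) (T : HermParam p) : ℝ := ∑ i, T.1 i

/-- The function `X ↦ det(X)^(α - p)` on the cone of positive definite matrices, extended by
`0`. -/
noncomputable def detPower (p : ℕ) (α : ℂ) : HermParam p → ℂ :=
  (posCone p).indicator fun T => (detHerm p T : ℂ) ^ (α - p)

lemma measurable_detPower (p : ℕ) (α : ℂ) : Measurable (detPower p α) :=
  Measurable.indicator ((Complex.measurable_ofReal.comp (measurable_detHerm p)).pow_const _)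
    (measurableSet_posCone p)

/-- The integrand of the matrix-variate gamma integral. -/
noncomputable def gammaIntegrand (p : ℕ) (α : ℂ) (T : HermParam p) : ℂ :=
  detPower p α T * (Real.exp (-traceHerm p T) : ℂ)

lemma measurable_gammaIntegrand (p : ℕ) (α : ℂ) : Measurable (gammaIntegrand p α) := by
  refine (measurable_detPower p α).mul ?_
  unfold traceHerm
  fun_prop

/-- The parameters of the block matrix with corner `a`, first row `b` and lower block `T`. -/
noncomputable def hermSucc (p : ℕ) (x : (ℝ × (Fin p → ℂ)) × HermParam p) : HermParam (p + 1) :=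
  (Fin.cons x.1.1 x.2.1, fun q => Sum.elim x.1.2 x.2.2 ((increasingPairsSucc p).symm q))

lemma measurePreserving_prod_comm_middle {A B X Y : Type*} [MeasureSpace A] [MeasureSpace B]
    [MeasureSpace X] [MeasureSpace Y] [SigmaFinite (volume : Measure A)]
    [SigmaFinite (volume : Measure B)] [SigmaFinite (volume : Measure X)]
    [SigmaFinite (volume : Measure Y)] :
    MeasurePreserving (fun x : (A × B) × (X × Y) => ((x.1.1, x.2.1), (x.1.2, x.2.2))) := by
  have h1 := volume_preserving_prodAssoc (α₁ := A) (β₁ := B) (γ₁ := X × Y)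
  have h2 := (volume_preserving_prodAssoc (α₁ := B) (β₁ := X) (γ₁ := Y)).symm
  have h3 : MeasurePreserving (Prod.map Prod.swap id : (B × X) × Y → (X × B) × Y) :=
    (Measure.measurePreserving_swap (μ := (volume : Measure B)) (ν := (volume : Measure X))).prod
      (MeasurePreserving.id (volume : Measure Y))
  have h4 := volume_preserving_prodAssoc (α₁ := X) (β₁ := B) (γ₁ := Y)
  have h5 := (MeasurePreserving.id (volume : Measure A)).prod ((h4.comp h3).comp h2)
  have h6 := (volume_preserving_prodAssoc (α₁ := A) (β₁ := X) (γ₁ := B × Y)).symm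
  exact (h6.comp h5).comp h1

lemma measurePreserving_hermSucc (p : ℕ) : MeasurePreserving (hermSucc p) := by
  have h1 := (volume_preserving_piFinSuccAbove (fun _ : Fin (p + 1) => ℝ) 0).symm
  have h2 := (volume_measurePreserving_piCongrLeft (fun _ => ℂ) (increasingPairsSucc p)).comp
    (volume_measurePreserving_sumPiEquivProdPi_symm
      (fun _ : Fin p ⊕ { q : Fin p × Fin p // q.1 < q.2 } => ℂ))
  have h3 := (h1.prod h2).comp (measurePreserving_prod_comm_middle (A := ℝ) (B := Fin p → ℂ)
    (X := Fin p → ℝ) (Y := { q : Fin p × Fin p // q.1 < q.2 } → ℂ))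
  change MeasurePreserving _ _ (Measure.prod _ _)
  convert h3 using 1
  funext x
  refine Prod.ext ?_ ?_
  · funext i
    refine Fin.cases ?_ (fun i => ?_) i
    · simp [hermSucc, MeasurableEquiv.piFinSuccAbove]
    · simp [hermSucc, MeasurableEquiv.piFinSuccAbove]
  · funext q
    obtain ⟨q, rfl⟩ := (increasingPairsSucc p).surjective q
    simp only [hermSucc, Equiv.symm_apply_apply, Function.comp_apply, Prod.map_apply]
    rw [MeasurableEquiv.piCongrLeft_apply_apply]
    rcases q with q | q <;> rfl

/-- The rank-one correction `bᴴ b / a` appearing in the Schur complement. -/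
noncomputable def schurCorrection {p : ℕ} (x : ℝ × (Fin p → ℂ)) : HermParam p :=
  hermParam (of fun i j => star (x.2 i) * x.2 j / (x.1 : ℂ))

lemma toHermMatrix_schurCorrection {p : ℕ} (x : ℝ × (Fin p → ℂ)) :
    toHermMatrix p (schurCorrection x) = of fun i j => star (x.2 i) * x.2 j / (x.1 : ℂ) := by
  refine toHermMatrix_hermParam ?_
  ext i j
  simp [mul_comm]

instance (p : ℕ) : (volume : Measure (HermParam p)).IsAddHaarMeasure :=
  Measure.prod.instIsAddHaarMeasure (volume : Measure (Fin p → ℝ))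
    (volume : Measure ({ q : Fin p × Fin p // q.1 < q.2 } → ℂ))

lemma measurePreserving_shear_schurCorrection (p : ℕ) :
    MeasurePreserving (fun x : (ℝ × (Fin p → ℂ)) × HermParam p =>
      (x.1, x.2 + schurCorrection x.1)) := by
  refine (MeasurePreserving.id (volume : Measure (ℝ × (Fin p → ℂ)))).skew_product
    (g := fun a T => T + schurCorrection a) ?_
    (Filter.Eventually.of_forall fun a => (measurePreserving_add_right volume _).map_eq)
  have : Measurable (schurCorrection (p := p)) := by
    unfold schurCorrection hermParam
    simp only [of_apply]
    fun_prop
  exact measurable_snd.add (this.comp measurable_fst)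

/-- Block coordinates, using the Schur complement as the lower block. -/
noncomputable def schurCoord (p : ℕ) (x : (ℝ × (Fin p → ℂ)) × HermParam p) : HermParam (p + 1) :=
  hermSucc p (x.1, x.2 + schurCorrection x.1)

lemma measurePreserving_schurCoord (p : ℕ) : MeasurePreserving (schurCoord p) :=
  (measurePreserving_hermSucc p).comp (measurePreserving_shear_schurCorrection p)

/-- `Fin (p + 1)` as a one-point type followed by `Fin p`. -/
noncomputable def unitSumFin (p : ℕ) : Unit ⊕ Fin p ≃ Fin (p + 1) :=
  Equiv.ofBijective (Sum.elim (fun _ => 0) Fin.succ) <| by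
    constructor
    · rintro (i | i) (j | j) <;> simp [(Fin.succ_ne_zero _).symm]
    · intro i
      refine Fin.cases ⟨Sum.inl (), rfl⟩ (fun i => ⟨Sum.inr i, rfl⟩) i

lemma unitSumFin_inl {p : ℕ} (u : Unit) : unitSumFin p (Sum.inl u) = 0 := rfl

lemma unitSumFin_inr {p : ℕ} (i : Fin p) : unitSumFin p (Sum.inr i) = i.succ := rfl

lemma toHermMatrix_hermSucc_submatrix {p : ℕ} (x : (ℝ × (Fin p → ℂ)) × HermParam p) :
    (toHermMatrix (p + 1) (hermSucc p x)).submatrix (unitSumFin p) (unitSumFin p) =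
      fromBlocks (of fun _ _ => (x.1.1 : ℂ)) (of fun _ j => x.1.2 j)
        (of fun _ j => x.1.2 j : Matrix Unit (Fin p) ℂ)ᴴ (toHermMatrix p x.2) := by
  have h0 : ∀ j : Fin p, (increasingPairsSucc p).symm ⟨(0, j.succ), j.succ_pos⟩ = Sum.inl j :=
    fun j => (Equiv.symm_apply_eq _).2 rfl
  have h1 : ∀ (i j : Fin p) (h : i < j), (increasingPairsSucc p).symm
      ⟨(i.succ, j.succ), Fin.succ_lt_succ_iff.2 h⟩ = Sum.inr ⟨(i, j), h⟩ :=
    fun i j h => (Equiv.symm_apply_eq _).2 rfl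
  ext (i | i) (j | j)
  · simp [unitSumFin_inl, toHermMatrix, hermSucc]
  · simp [unitSumFin_inl, unitSumFin_inr, toHermMatrix, hermSucc, h0]
  · simp [unitSumFin_inl, unitSumFin_inr, toHermMatrix, hermSucc, h0]
  · simp only [toHermMatrix, hermSucc, submatrix_apply, unitSumFin_inr, of_apply,
      fromBlocks_apply₂₂, Fin.succ_lt_succ_iff, Fin.cons_succ]
    split_ifs with h h'
    · rw [h1 i j h]; rfl
    · rw [h1 j i h']; rfl
    · rfl

lemma schur_block {p : ℕ} (a : ℝ) (b : Fin p → ℂ) (T : HermParam p) (ha : a ≠ 0)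
    [Invertible (of fun _ _ => (a : ℂ) : Matrix Unit Unit ℂ)] :
    toHermMatrix p (T + schurCorrection (a, b)) -
      (of fun _ j => b j : Matrix Unit (Fin p) ℂ)ᴴ * (of fun _ _ => (a : ℂ) : Matrix Unit Unit ℂ)⁻¹
        * (of fun _ j => b j : Matrix Unit (Fin p) ℂ) = toHermMatrix p T := by
  have h : (of fun _ _ => (a : ℂ) : Matrix Unit Unit ℂ)⁻¹ = of fun _ _ => (a : ℂ)⁻¹ := by
    refine inv_eq_right_inv ?_
    ext i j
    simp [Matrix.mul_apply, ha]
  rw [h, toHermMatrix_add, toHermMatrix_schurCorrection]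
  ext i j
  simp [Matrix.mul_apply]
  field_simp
  ring

lemma posDef_of_const_unit {a : ℝ} (ha : 0 < a) :
    (of fun _ _ => (a : ℂ) : Matrix Unit Unit ℂ).PosDef := by
  have : (of fun _ _ => (a : ℂ) : Matrix Unit Unit ℂ) = Matrix.diagonal fun _ => (a : ℂ) := by
    ext i j; simp
  rw [this]
  exact PosDef.diagonal fun _ => by simpa using ha

lemma detHerm_schurCoord {p : ℕ} {a : ℝ} (b : Fin p → ℂ) (T : HermParam p) (ha : 0 < a) :
    (toHermMatrix (p + 1) (schurCoord p ((a, b), T))).det = a * (toHermMatrix p T).det := by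
  let _ : Invertible (of fun _ _ => (a : ℂ) : Matrix Unit Unit ℂ) :=
    (posDef_of_const_unit ha).isUnit.invertible
  rw [← det_submatrix_equiv_self (unitSumFin p), schurCoord, toHermMatrix_hermSucc_submatrix,
    det_fromBlocks₁₁, invOf_eq_nonsing_inv]
  dsimp only
  rw [schur_block a b T ha.ne']
  simp

lemma schurCoord_mem_posCone {p : ℕ} {a : ℝ} (b : Fin p → ℂ) (T : HermParam p) (ha : 0 < a) :
    schurCoord p ((a, b), T) ∈ posCone (p + 1) ↔ T ∈ posCone p := by
  let _ : Invertible (of fun _ _ => (a : ℂ) : Matrix Unit Unit ℂ) :=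
    (posDef_of_const_unit ha).isUnit.invertible
  have hs : (toHermMatrix (p + 1) (schurCoord p ((a, b), T))).PosSemidef ↔
      (toHermMatrix p T).PosSemidef := by
    rw [← posSemidef_submatrix_equiv (unitSumFin p), schurCoord, toHermMatrix_hermSucc_submatrix,
      PosDef.fromBlocks₁₁ _ _ (posDef_of_const_unit ha)]
    dsimp only
    rw [schur_block a b T ha.ne']
  simp only [posCone, mem_ofPred_eq]
  constructor
  · intro h
    have h' := hs.1 h.posSemidef
    rw [h'.posDef_iff_det_ne_zero]
    have := h.posSemidef.posDef_iff_det_ne_zero.1 h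
    rw [detHerm_schurCoord b T ha] at this
    exact right_ne_zero_of_mul this
  · intro h
    have h' := hs.2 h.posSemidef
    rw [h'.posDef_iff_det_ne_zero, detHerm_schurCoord b T ha]
    exact mul_ne_zero (by exact_mod_cast ha.ne') (h.posSemidef.posDef_iff_det_ne_zero.1 h)

lemma pos_of_schurCoord_mem_posCone {p : ℕ} {x : (ℝ × (Fin p → ℂ)) × HermParam p}
    (h : schurCoord p x ∈ posCone (p + 1)) : 0 < x.1.1 := by
  have := PosDef.diag_pos h (i := 0)
  simpa [toHermMatrix, schurCoord, hermSucc] using this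

lemma traceHerm_schurCoord {p : ℕ} (a : ℝ) (b : Fin p → ℂ) (T : HermParam p) :
    traceHerm (p + 1) (schurCoord p ((a, b), T)) =
      a + traceHerm p T + ∑ i, ‖b i‖ ^ 2 / a := by
  simp only [traceHerm, schurCoord, hermSucc, Fin.sum_univ_succ, Fin.cons_zero, Fin.cons_succ,
    Prod.fst_add, Pi.add_apply, Finset.sum_add_distrib, add_assoc]
  congr 2
  refine Finset.sum_congr rfl fun i _ => ?_
  simp only [schurCorrection, hermParam, of_apply, Complex.div_ofReal_re]
  congr 1
  rw [← Complex.normSq_eq_norm_sq, Complex.normSq_apply]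
  simp

/-- The factor of the gamma integrand depending on the first row. -/
noncomputable def rowFactor (p : ℕ) (α : ℂ) (x : ℝ × (Fin p → ℂ)) : ℂ :=
  (Ioi (0 : ℝ)).indicator (fun a : ℝ => (Real.exp (-a) : ℂ) * (a : ℂ) ^ (α - (p + 1))) x.1 *
    ∏ i, ((Real.exp (-x.1⁻¹ * ‖x.2 i‖ ^ 2) : ℝ) : ℂ)

lemma gammaIntegrand_schurCoord (p : ℕ) (α : ℂ) (x : (ℝ × (Fin p → ℂ)) × HermParam p) :
    gammaIntegrand (p + 1) α (schurCoord p x) = rowFactor p α x.1 * gammaIntegrand p (α - 1) x.2 := by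
  obtain ⟨⟨a, b⟩, T⟩ := x
  by_cases ha : 0 < a
  · by_cases hT : T ∈ posCone p
    · have hx := (schurCoord_mem_posCone b T ha).2 hT
      have hd : detHerm (p + 1) (schurCoord p ((a, b), T)) = a * detHerm p T := by
        rw [detHerm, detHerm_schurCoord b T ha, Complex.re_ofReal_mul]; rfl
      have he : Real.exp (-traceHerm (p + 1) (schurCoord p ((a, b), T))) =
          Real.exp (-a) * Real.exp (-traceHerm p T) * ∏ i, Real.exp (-a⁻¹ * ‖b i‖ ^ 2) := by
        rw [traceHerm_schurCoord, ← Real.exp_sum, ← Real.exp_add, ← Real.exp_add,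
          ← Finset.mul_sum, ← Finset.sum_div]
        congr 1
        ring
      simp only [gammaIntegrand, detPower, rowFactor, indicator_of_mem hx, indicator_of_mem hT,
        indicator_of_mem (mem_Ioi.2 ha), hd, he]
      push_cast
      rw [Complex.mul_cpow_ofReal_nonneg ha.le (detHerm_pos hT).le, sub_sub α 1, add_comm 1 (p : ℂ)]
      ring
    · have hx := mt (schurCoord_mem_posCone b T ha).1 hT
      simp [gammaIntegrand, detPower, hx, hT]
  · have hx : schurCoord p ((a, b), T) ∉ posCone (p + 1) :=
      fun h => ha (pos_of_schurCoord_mem_posCone h)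
    simp [gammaIntegrand, detPower, rowFactor, hx, ha]

lemma integral_prod_exp_neg_norm_sq (p : ℕ) {a : ℝ} (ha : 0 < a) :
    ∫ b : Fin p → ℂ, ∏ i, Real.exp (-a⁻¹ * ‖b i‖ ^ 2) = (Real.pi * a) ^ p := by
  rw [integral_fintype_prod_volume_eq_pow fun z : ℂ => Real.exp (-a⁻¹ * ‖z‖ ^ 2),
    Fintype.card_fin]
  have := GaussianFourier.integral_rexp_neg_mul_sq_norm (V := ℂ) (inv_pos.2 ha)
  rw [this, Complex.finrank_real_complex]
  simp

lemma integrable_prod_exp_neg_norm_sq (p : ℕ) {a : ℝ} (ha : 0 < a) :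
    Integrable fun b : Fin p → ℂ => ∏ i, Real.exp (-a⁻¹ * ‖b i‖ ^ 2) := by
  by_contra h
  have h0 := integral_undef h
  rw [integral_prod_exp_neg_norm_sq p ha] at h0
  exact (pow_pos (mul_pos Real.pi_pos ha) p).ne' h0

lemma measurable_rowFactor (p : ℕ) (α : ℂ) : Measurable (rowFactor p α) := by
  unfold rowFactor
  refine Measurable.mul ?_ (by fun_prop)
  refine (Measurable.indicator ?_ measurableSet_Ioi).comp measurable_fst
  refine Measurable.mul (by fun_prop) (Complex.measurable_ofReal.pow_const _)

/-- The result of integrating `rowFactor` over the off-diagonal part of the row. -/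
noncomputable def cornerFactor (p : ℕ) (α : ℂ) : ℝ → ℂ :=
  (Ioi (0 : ℝ)).indicator fun a =>
    (Real.pi : ℂ) ^ p * ((Real.exp (-a) : ℂ) * (a : ℂ) ^ (α - 1))

lemma cornerFactor_eq (p : ℕ) (α : ℂ) {a : ℝ} (ha : 0 < a) :
    cornerFactor p α a =
      ((Real.exp (-a) : ℂ) * (a : ℂ) ^ (α - (p + 1))) * ((Real.pi * a) ^ p : ℝ) := by
  have ha' : (a : ℂ) ≠ 0 := by exact_mod_cast ha.ne'
  have : (a : ℂ) ^ (α - 1) = (a : ℂ) ^ (α - (p + 1)) * (a : ℂ) ^ p := by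
    rw [← Complex.cpow_natCast, ← Complex.cpow_add _ _ ha']
    congr 1
    ring
  rw [cornerFactor, indicator_of_mem (mem_Ioi.2 ha), this]
  push_cast
  ring

lemma integral_rowFactor_right (p : ℕ) (α : ℂ) (a : ℝ) :
    ∫ b, rowFactor p α (a, b) = cornerFactor p α a := by
  by_cases ha : 0 < a
  · simp only [rowFactor, indicator_of_mem (mem_Ioi.2 ha), ← Complex.ofReal_prod]
    rw [integral_const_mul, cornerFactor_eq p α ha, ← integral_prod_exp_neg_norm_sq p ha,
      integral_complex_ofReal]
  · simp [rowFactor, cornerFactor, ha]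

lemma integral_norm_rowFactor_right (p : ℕ) (α : ℂ) (a : ℝ) :
    ∫ b, ‖rowFactor p α (a, b)‖ = ‖cornerFactor p α a‖ := by
  by_cases ha : 0 < a
  · simp only [rowFactor, indicator_of_mem (mem_Ioi.2 ha), ← Complex.ofReal_prod]
    simp only [norm_mul, Complex.norm_real]
    rw [integral_const_mul, cornerFactor_eq p α ha, ← integral_prod_exp_neg_norm_sq p ha]
    simp only [norm_mul, Complex.norm_real]
    congr 1
    rw [Real.norm_of_nonneg (integral_nonneg fun b => by positivity)]
    congr 1
    funext b
    exact Real.norm_of_nonneg (by positivity)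
  · simp [rowFactor, cornerFactor, ha]

lemma integrable_cornerFactor (p : ℕ) {α : ℂ} (hα : 0 < α.re) :
    Integrable (cornerFactor p α) :=
  (integrable_indicator_iff measurableSet_Ioi).2
    ((Complex.GammaIntegral_convergent hα).const_mul _)

lemma integral_cornerFactor (p : ℕ) {α : ℂ} (hα : 0 < α.re) :
    ∫ a, cornerFactor p α a = (Real.pi : ℂ) ^ p * Complex.Gamma α := by
  rw [cornerFactor, integral_indicator measurableSet_Ioi, integral_const_mul,
    Complex.Gamma_eq_integral hα, Complex.GammaIntegral]

lemma integrable_rowFactor (p : ℕ) {α : ℂ} (hα : 0 < α.re) : Integrable (rowFactor p α) := by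
  refine (integrable_prod_iff (measurable_rowFactor p α).aestronglyMeasurable).2 ⟨?_, ?_⟩
  · refine Filter.Eventually.of_forall fun a => ?_
    by_cases ha : 0 < a
    · simp only [rowFactor, indicator_of_mem (mem_Ioi.2 ha), ← Complex.ofReal_prod]
      exact (integrable_prod_exp_neg_norm_sq p ha).ofReal.const_mul _
    · simp [rowFactor, ha]
  · simp only [integral_norm_rowFactor_right]
    exact (integrable_cornerFactor p hα).norm

lemma integral_rowFactor (p : ℕ) {α : ℂ} (hα : 0 < α.re) :
    ∫ x, rowFactor p α x = (Real.pi : ℂ) ^ p * Complex.Gamma α := by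
  rw [Measure.volume_eq_prod, integral_prod _ (integrable_rowFactor p hα)]
  simp only [integral_rowFactor_right, integral_cornerFactor p hα]

lemma cGammaP_succ (p : ℕ) (α : ℂ) :
    cGammaP (p + 1) α = ((Real.pi : ℂ) ^ p * Complex.Gamma α) * cGammaP p (α - 1) := by
  rw [cGammaP, cGammaP, Fin.prod_univ_succ, Nat.triangle_succ, pow_add]
  simp only [Fin.val_zero, Fin.val_succ, Nat.cast_zero, sub_zero, Nat.cast_succ]
  simp only [sub_sub, add_comm (1 : ℂ)]
  ring

theorem gamma_integral (p : ℕ) {α : ℂ} (hα : (p - 1 : ℝ) < α.re) :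
    Integrable (gammaIntegrand p α) ∧ ∫ T, gammaIntegrand p α T = cGammaP p α := by
  induction p generalizing α with
  | zero =>
    have h : gammaIntegrand 0 α = fun _ => 1 := by
      funext T
      have : T ∈ posCone 0 := by
        have : toHermMatrix 0 T = 1 := Subsingleton.elim _ _
        simp only [posCone, mem_ofPred_eq, this]
        exact PosDef.one
      simp [gammaIntegrand, detPower, this, detHerm, traceHerm]
    have hv : (volume : Measure (HermParam 0)) univ = 1 := by
      rw [Measure.volume_eq_prod, ← univ_prod_univ, Measure.prod_prod, volume_pi, volume_pi,
        ← pi_univ, ← pi_univ, Measure.pi_pi, Measure.pi_pi]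
      simp
    have : IsProbabilityMeasure (volume : Measure (HermParam 0)) := ⟨hv⟩
    rw [h]
    refine ⟨integrable_const _, ?_⟩
    simp [cGammaP]
  | succ p ih =>
    have hα' : (p - 1 : ℝ) < (α - 1).re := by
      push_cast at hα
      simp only [Complex.sub_re, Complex.one_re]
      linarith
    have h0 : 0 < α.re := by
      have : (0 : ℝ) ≤ p := p.cast_nonneg
      push_cast at hα
      linarith
    obtain ⟨ih1, ih2⟩ := ih hα'
    have hm := (measurable_gammaIntegrand (p + 1) α).aestronglyMeasurable (μ := volume)
    have hp := measurePreserving_schurCoord p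
    have hc : gammaIntegrand (p + 1) α ∘ schurCoord p =
        fun x => rowFactor p α x.1 * gammaIntegrand p (α - 1) x.2 :=
      funext (gammaIntegrand_schurCoord p α)
    constructor
    · rw [← hp.integrable_comp hm, hc]
      exact (integrable_rowFactor p h0).mul_prod ih1
    · rw [← hp.map_eq, integral_map hp.measurable.aemeasurable (by rwa [hp.map_eq])]
      simp only [gammaIntegrand_schurCoord]
      rw [Measure.volume_eq_prod, integral_prod_mul, integral_rowFactor p h0, ih2, cGammaP_succ]

instance (m n : ℕ) : SecondCountableTopology (Matrix (Fin m) (Fin n) ℂ) :=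
  inferInstanceAs (SecondCountableTopology (Fin m → Fin n → ℂ))

instance (p : ℕ) : SigmaFinite (volume : Measure (HermParam p)) :=
  Measure.prod.instSigmaFinite (μ := (volume : Measure (Fin p → ℝ)))

instance (p : ℕ) : SecondCountableTopology (HermParam p) :=
  inferInstanceAs (SecondCountableTopology
    ((Fin p → ℝ) × ({ q : Fin p × Fin p // q.1 < q.2 } → ℂ)))

instance (p : ℕ) : BorelSpace (HermParam p) :=
  Prod.borelSpace (α := Fin p → ℝ) (β := { q : Fin p × Fin p // q.1 < q.2 } → ℂ)

instance (p k : ℕ) : BorelSpace (Fin k → HermParam p) :=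
  Pi.borelSpace

instance (p k : ℕ) : SigmaFinite (volume : Measure (Fin k → HermParam p)) :=
  Measure.pi.sigmaFinite _

instance (p k : ℕ) : (volume : Measure (Fin k → HermParam p)).IsAddHaarMeasure :=
  Measure.pi.isAddHaarMeasure _

lemma detHerm_congrHerm {p : ℕ} {A Y : Matrix (Fin p) (Fin p) ℂ} (hY : Y.PosDef)
    (hA : A * Aᴴ = Y) (T : HermParam p) :
    detHerm p (congrHerm A T) = Y.det.re * detHerm p T := by
  have h : (A * toHermMatrix p T * Aᴴ).det = Y.det * (toHermMatrix p T).det := by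
    rw [← hA, det_mul, det_mul, det_mul]
    ring
  have h0 : Y.det.im = 0 := (Complex.pos_iff.1 hY.det_pos).2.symm
  rw [detHerm, toHermMatrix_congrHerm, h, Complex.mul_re, h0, zero_mul, sub_zero, detHerm]

lemma congrHerm_mem_posCone_iff {p : ℕ} {A : Matrix (Fin p) (Fin p) ℂ} (hA : IsUnit A)
    (T : HermParam p) : congrHerm A T ∈ posCone p ↔ T ∈ posCone p := by
  simp only [posCone, mem_ofPred_eq, toHermMatrix_congrHerm]
  exact hA.posDef_star_right_conjugate_iff

lemma detPower_congrHerm {p : ℕ} {A Y : Matrix (Fin p) (Fin p) ℂ} (hY : Y.PosDef)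
    (hAu : IsUnit A) (hA : A * Aᴴ = Y) (α : ℂ) (T : HermParam p) :
    detPower p α (congrHerm A T) = (Y.det.re : ℂ) ^ (α - p) * detPower p α T := by
  by_cases hT : T ∈ posCone p
  · rw [detPower, indicator_of_mem ((congrHerm_mem_posCone_iff hAu T).2 hT), indicator_of_mem hT,
      detHerm_congrHerm hY hA, Complex.ofReal_mul,
      Complex.mul_cpow_ofReal_nonneg (Complex.pos_iff.1 hY.det_pos).1.le (detHerm_pos hT).le]
  · rw [detPower, indicator_of_notMem (mt (congrHerm_mem_posCone_iff hAu T).1 hT),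
      indicator_of_notMem hT, mul_zero]

lemma add_mem_posCone {p : ℕ} {ι : Type*} (s : Finset ι) {T : HermParam p} {X : ι → HermParam p}
    (hT : T ∈ posCone p) (hX : ∀ i ∈ s, X i ∈ posCone p) : T + ∑ i ∈ s, X i ∈ posCone p := by
  simp only [posCone, mem_ofPred_eq, toHermMatrix_add, toHermMatrix_sum] at *
  exact hT.add_posSemidef (posSemidef_sum s fun i hi => (hX i hi).posSemidef)

/-- The unnormalized type-1 Dirichlet density on the set of tuples with sum below `Y`. -/
noncomputable def dirichletIntegrand (p : ℕ) {k : ℕ} (a : Fin k → ℂ) (β : ℂ) (Y : HermParam p)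
    (X : Fin k → HermParam p) : ℂ :=
  (∏ j, detPower p (a j) (X j)) * detPower p β (Y - ∑ j, X j)

lemma measurable_dirichletIntegrand (p : ℕ) {k : ℕ} (a : Fin k → ℂ) (β : ℂ) (Y : HermParam p) :
    Measurable (dirichletIntegrand p a β Y) := by
  refine Measurable.mul ?_ ((measurable_detPower p β).comp (by fun_prop))
  exact Finset.measurable_prod _ fun j _ => (measurable_detPower p (a j)).comp
    (measurable_pi_apply j)

lemma dirichletIntegrand_eq_zero {p k : ℕ} (a : Fin k → ℂ) (β : ℂ) {Y : HermParam p}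
    (hY : Y ∉ posCone p) (X : Fin k → HermParam p) : dirichletIntegrand p a β Y X = 0 := by
  by_cases hX : ∀ j, X j ∈ posCone p
  · have : Y - ∑ j, X j ∉ posCone p := fun h => hY <| by
      simpa using add_mem_posCone Finset.univ h fun j _ => hX j
    simp [dirichletIntegrand, detPower, this]
  · obtain ⟨j, hj⟩ := not_forall.1 hX
    rw [dirichletIntegrand, Finset.prod_eq_zero (Finset.mem_univ j), zero_mul]
    simp [detPower, hj]

lemma pow_mul_prod_cpow {k : ℕ} (p : ℕ) {d : ℂ} (hd : d ≠ 0) (a : Fin k → ℂ) (β : ℂ) :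
    (d ^ p) ^ k * ((∏ j, d ^ (a j - p)) * d ^ (β - p)) = d ^ (∑ j, a j + β - p) := by
  induction k with
  | zero => simp
  | succ k ih =>
    have h1 : d ^ (a 0 - p) * d ^ p = d ^ a 0 := by
      rw [← Complex.cpow_natCast, ← Complex.cpow_add _ _ hd, sub_add_cancel]
    have h2 : d ^ (∑ j, a j + β - p) = d ^ a 0 * d ^ (∑ j : Fin k, a j.succ + β - p) := by
      rw [← Complex.cpow_add _ _ hd, Fin.sum_univ_succ]
      congr 1
      ring
    rw [h2, ← ih fun j => a j.succ, ← h1, Fin.prod_univ_succ]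
    ring

lemma integral_dirichletIntegrand (p : ℕ) {k : ℕ} (a : Fin k → ℂ) (β : ℂ) (Y : HermParam p) :
    ∫ X, dirichletIntegrand p a β Y X =
      detPower p (∑ j, a j + β) Y * ∫ X, dirichletIntegrand p a β (hermParam 1) X := by
  by_cases hY : Y ∈ posCone p
  swap
  · simp only [dirichletIntegrand_eq_zero a β hY, integral_zero, detPower,
      indicator_of_notMem hY, zero_mul]
  obtain ⟨A, hAu, hA, hdet⟩ := exists_congr_factor hY
  have hd : 0 < (toHermMatrix p Y).det.re := detHerm_pos hY
  have hE : congrHerm A (hermParam 1) = Y := by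
    apply toHermMatrix_injective p
    rw [toHermMatrix_congrHerm, toHermMatrix_hermParam isHermitian_one, mul_one, hA]
  set L : (Fin k → HermParam p) →ₗ[ℝ] (Fin k → HermParam p) :=
    LinearMap.pi fun i => congrHerm A ∘ₗ LinearMap.proj i
  have hL : LinearMap.det L = ((toHermMatrix p Y).det.re ^ p) ^ k := by
    rw [LinearMap.det_pi, hdet, Finset.prod_const, Finset.card_univ, Fintype.card_fin]
  have hL0 : 0 < LinearMap.det L := by
    rw [hL]
    positivity
  have hmap := Measure.map_linearMap_addHaar_eq_smul_addHaar
    (μ := (volume : Measure (Fin k → HermParam p))) hL0.ne'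
  have hcomp : ∀ U, dirichletIntegrand p a β Y (L U) =
      ((∏ j, ((toHermMatrix p Y).det.re : ℂ) ^ (a j - p)) *
        ((toHermMatrix p Y).det.re : ℂ) ^ (β - p)) *
        dirichletIntegrand p a β (hermParam 1) U := by
    intro U
    have h1 : Y - ∑ j, L U j = congrHerm A (hermParam 1 - ∑ j, U j) := by
      rw [map_sub, map_sum, hE]
      rfl
    have h2 : ∀ j, L U j = congrHerm A (U j) := fun j => rfl
    simp only [dirichletIntegrand, h1]
    simp only [h2, detPower_congrHerm hY hAu hA, Finset.prod_mul_distrib]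
    ring
  have hLm : Measurable L := L.continuous_of_finiteDimensional.measurable
  have hint := integral_map (μ := (volume : Measure (Fin k → HermParam p))) hLm.aemeasurable
    (measurable_dirichletIntegrand p a β Y).aestronglyMeasurable
  rw [hmap, integral_smul_measure] at hint
  simp only [hcomp, integral_const_mul] at hint
  rw [ENNReal.toReal_ofReal (abs_nonneg _), abs_of_pos (inv_pos.2 hL0), inv_smul_eq_iff₀ hL0.ne',
    hL] at hint
  rw [hint, detPower, indicator_of_mem hY, detHerm,
    ← pow_mul_prod_cpow p (Complex.ofReal_ne_zero.2 hd.ne') a β, Complex.real_smul]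
  push_cast
  ring

lemma traceHerm_sub (p : ℕ) (S T : HermParam p) :
    traceHerm p (S - T) = traceHerm p S - traceHerm p T := by
  simp [traceHerm]

lemma traceHerm_sum (p : ℕ) {k : ℕ} (X : Fin k → HermParam p) :
    traceHerm p (∑ j, X j) = ∑ j, traceHerm p (X j) := by
  simp only [traceHerm, Prod.fst_sum, Finset.sum_apply]
  exact Finset.sum_comm

lemma prod_gammaIntegrand_mul (p : ℕ) {k : ℕ} (a : Fin k → ℂ) (β : ℂ) (Y : HermParam p)
    (X : Fin k → HermParam p) :
    (∏ j, gammaIntegrand p (a j) (X j)) * gammaIntegrand p β (Y - ∑ j, X j) =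
      dirichletIntegrand p a β Y X * (Real.exp (-traceHerm p Y) : ℂ) := by
  have h : Real.exp (-traceHerm p Y) =
      (∏ j, Real.exp (-traceHerm p (X j))) * Real.exp (-traceHerm p (Y - ∑ j, X j)) := by
    rw [← Real.exp_sum, ← Real.exp_add, traceHerm_sub, traceHerm_sum, Finset.sum_neg_distrib]
    congr 1
    ring
  rw [h, dirichletIntegrand]
  simp only [gammaIntegrand, Finset.prod_mul_distrib, Complex.ofReal_mul, Complex.ofReal_prod]
  ring

theorem prod_cGammaP_mul (p : ℕ) {k : ℕ} {a : Fin k → ℂ} {β : ℂ}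
    (ha : ∀ j, (p - 1 : ℝ) < (a j).re) (hβ : (p - 1 : ℝ) < β.re)
    (hs : (p - 1 : ℝ) < (∑ j, a j + β).re) :
    (∏ j, cGammaP p (a j)) * cGammaP p β =
      (∫ X, dirichletIntegrand p a β (hermParam 1) X) * cGammaP p (∑ j, a j + β) := by
  set G : (Fin k → HermParam p) × HermParam p → ℂ := fun x =>
    (∏ j, gammaIntegrand p (a j) (x.1 j)) * gammaIntegrand p β x.2
  set S : (Fin k → HermParam p) × HermParam p → (Fin k → HermParam p) × HermParam p :=
    fun x => (x.1, x.2 - ∑ j, x.1 j)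
  have hS : MeasurePreserving S :=
    (MeasurePreserving.id (volume : Measure (Fin k → HermParam p))).skew_product
      (g := fun X Y => Y - ∑ j, X j) (by fun_prop)
      (Filter.Eventually.of_forall fun X => (measurePreserving_sub_right volume _).map_eq)
  have hG : Integrable G :=
    (Integrable.fintype_prod fun j => (gamma_integral p (ha j)).1).mul_prod
      (gamma_integral p hβ).1
  have hGS : ∀ x, G (S x) =
      dirichletIntegrand p a β x.2 x.1 * (Real.exp (-traceHerm p x.2) : ℂ) :=
    fun x => prod_gammaIntegrand_mul p a β x.2 x.1
  have hI : ∫ x, G x = (∏ j, cGammaP p (a j)) * cGammaP p β := by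
    rw [Measure.volume_eq_prod, integral_prod_mul (fun X : Fin k → HermParam p =>
      ∏ j, gammaIntegrand p (a j) (X j)), (gamma_integral p hβ).2,
      integral_fintype_prod_volume_eq_prod]
    simp only [(gamma_integral p (ha _)).2]
  have hGS' : Integrable fun x => G (S x) := hS.integrable_comp_of_integrable hG
  have hIS : ∫ x, G (S x) = ∫ x, G x := by
    conv_rhs => rw [← hS.map_eq]
    rw [integral_map hS.measurable.aemeasurable]
    rw [hS.map_eq]
    exact hG.aestronglyMeasurable
  rw [← hI, ← hIS, Measure.volume_eq_prod, integral_prod_symm _ hGS']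
  simp only [hGS, integral_mul_const]
  rw [← (gamma_integral p hs).2, ← integral_const_mul]
  congr 1
  funext Y
  rw [integral_dirichletIntegrand p a β Y, gammaIntegrand]
  ring

lemma cGammaP_ne_zero {p : ℕ} {α : ℂ} (hα : (p - 1 : ℝ) < α.re) : cGammaP p α ≠ 0 := by
  refine mul_ne_zero (pow_ne_zero _ (Complex.ofReal_ne_zero.2 Real.pi_ne_zero))
    (Finset.prod_ne_zero_iff.2 fun j _ => Complex.Gamma_ne_zero_of_re_pos ?_)
  have : (j + 1 : ℝ) ≤ p := by exact_mod_cast j.2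
  simp only [Complex.sub_re, Complex.natCast_re]
  linarith

lemma integral_pi_hermLebesgue (p k : ℕ) (s : Set (Fin k → Matrix (Fin p) (Fin p) ℂ))
    (f : (Fin k → Matrix (Fin p) (Fin p) ℂ) → ℂ) (hs : MeasurableSet s) :
    ∫ X in s, f X ∂(Measure.pi fun _ : Fin k => hermLebesgue p) =
      ∫ T : Fin k → HermParam p, s.indicator f fun j => toHermMatrix p (T j) := by
  have he := measurableEmbedding_toHermMatrix p
  have : SigmaFinite (Measure.map (toHermMatrix p) volume) := he.sigmaFinite_map
  have hpi := Measure.pi_map_pi (μ := fun _ : Fin k => (volume : Measure (HermParam p)))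
    (f := fun _ => toHermMatrix p) (fun _ => he.measurable.aemeasurable)
  have hemb : MeasurableEmbedding
      (fun (T : Fin k → HermParam p) j => toHermMatrix p (T j)) :=
    (LinearMap.isClosedEmbedding_of_injective
      (f := (hermLinear p).compLeft (Fin k))
      (LinearMap.ker_eq_bot.2 (toHermMatrix_injective p).comp_left)).measurableEmbedding
  rw [← integral_indicator hs]
  simp only [hermLebesgue]
  rw [← hpi, hemb.integral_map]
  rfl

/-- The set of `k`-tuples of positive definite matrices whose sum is below the identity. -/
def dirichletDomain (p k : ℕ) : Set (Fin k → Matrix (Fin p) (Fin p) ℂ) :=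
  {X | (∀ j, (X j).PosDef) ∧ (1 - ∑ j, X j).PosDef}

lemma measurableSet_dirichletDomain (p k : ℕ) : MeasurableSet (dirichletDomain p k) := by
  have h := measurableSet_setOf_posDef p
  rw [dirichletDomain, ofPred_and, ofPred_forall]
  refine MeasurableSet.inter ?_ ?_
  · exact MeasurableSet.iInter fun j => h.preimage (measurable_pi_apply j)
  · have hc : Continuous fun X : Fin k → Matrix (Fin p) (Fin p) ℂ => 1 - ∑ j, X j := by
      fun_prop
    exact h.preimage hc.measurable

lemma indicator_dirichletDomain (p k : ℕ) (a : Fin k → ℂ) (β δ C : ℂ)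
    (T : Fin k → HermParam p) :
    (dirichletDomain p k).indicator (fun X =>
      (((1 - ∑ j, X j).det.re : ℂ) ^ δ) *
        (C * (∏ j, ((X j).det.re : ℂ) ^ (a j - p)) *
          (((1 - ∑ j, X j).det.re : ℂ) ^ (β - p)))) (fun j => toHermMatrix p (T j)) =
      C * dirichletIntegrand p a (β + δ) (hermParam 1) T := by
  have hE : (1 : Matrix (Fin p) (Fin p) ℂ) - ∑ j, toHermMatrix p (T j) =
      toHermMatrix p (hermParam 1 - ∑ j, T j) := by
    rw [toHermMatrix_sub, toHermMatrix_sum, toHermMatrix_hermParam isHermitian_one]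
  by_cases h : (fun j => toHermMatrix p (T j)) ∈ dirichletDomain p k
  · obtain ⟨h1, h2⟩ := id h
    rw [indicator_of_mem h]
    rw [hE] at h2
    have h1' : ∀ j, T j ∈ posCone p := h1
    have h2' : hermParam 1 - ∑ j, T j ∈ posCone p := h2
    have h0 : (detHerm p (hermParam 1 - ∑ j, T j) : ℂ) ≠ 0 :=
      Complex.ofReal_ne_zero.2 (detHerm_pos h2').ne'
    simp only [dirichletIntegrand, detPower, indicator_of_mem (h1' _), indicator_of_mem h2', hE]
    change (detHerm p (hermParam 1 - ∑ j, T j) : ℂ) ^ δ * (C *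
      (∏ j, (detHerm p (T j) : ℂ) ^ (a j - p)) *
        (detHerm p (hermParam 1 - ∑ j, T j) : ℂ) ^ (β - p)) = _
    rw [show β + δ - p = δ + (β - p) by ring, Complex.cpow_add _ _ h0]
    ring
  · rw [indicator_of_notMem h]
    by_cases h1 : ∀ j, T j ∈ posCone p
    · have h2 : hermParam 1 - ∑ j, T j ∉ posCone p := fun h2 => h ⟨h1, by
        rw [hE]
        exact h2⟩
      simp [dirichletIntegrand, detPower, h2]
    · obtain ⟨j, hj⟩ := not_forall.1 h1
      rw [dirichletIntegrand, Finset.prod_eq_zero (Finset.mem_univ j), zero_mul, mul_zero]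
      simp [detPower, hj]

end

theorem stmt10 (p k : ℕ) (hp : 1 ≤ p) (hk : 1 ≤ k)
    (α : Fin (k + 1) → ℂ) (δ : ℂ)
    (hα : ∀ j, (p - 1 : ℝ) < (α j).re)
    (hδ : (p - 1 : ℝ) < (α (Fin.last k) + δ).re) :
    ∫ X in {X : Fin k → Matrix (Fin p) (Fin p) ℂ |
        (∀ j, (X j).PosDef) ∧ (1 - ∑ j, X j).PosDef},
      ((((1 - ∑ j, X j).det.re : ℂ) ^ δ) *
        ((cGammaP p (∑ j, α j) / ∏ j : Fin (k + 1), cGammaP p (α j)) *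
          (∏ j : Fin k, ((X j).det.re : ℂ) ^ (α j.castSucc - p)) *
          (((1 - ∑ j, X j).det.re : ℂ) ^ (α (Fin.last k) - p))))
      ∂(Measure.pi fun _ : Fin k => hermLebesgue p)
    = (cGammaP p (α (Fin.last k) + δ) / cGammaP p (α (Fin.last k))) *
        cGammaP p (∑ j, α j) / cGammaP p ((∑ j, α j) + δ) := by
  have hβ := hα (Fin.last k)
  have hp' : (1 : ℝ) ≤ p := by exact_mod_cast hp
  have hsum : (0 : ℝ) ≤ (∑ j : Fin k, α j.castSucc).re := by
    rw [Complex.re_sum]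
    exact Finset.sum_nonneg fun j _ => by linarith [hα j.castSucc]
  have hs : (p - 1 : ℝ) < (∑ j : Fin k, α j.castSucc + (α (Fin.last k) + δ)).re := by
    rw [Complex.add_re]
    linarith
  have key := prod_cGammaP_mul p (fun j : Fin k => hα j.castSucc) hδ hs
  have hprod : ∏ j : Fin k, cGammaP p (α j.castSucc) ≠ 0 :=
    Finset.prod_ne_zero_iff.2 fun j _ => cGammaP_ne_zero (hα j.castSucc)
  have h1 := cGammaP_ne_zero hβ
  have h2 := cGammaP_ne_zero hs
  refine (integral_pi_hermLebesgue p k _ _ (measurableSet_dirichletDomain p k)).trans ?_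
  simp only [indicator_dirichletDomain, integral_const_mul]
  have hlast : ∑ j, α j + δ = ∑ j : Fin k, α j.castSucc + (α (Fin.last k) + δ) := by
    rw [Fin.sum_univ_castSucc, add_assoc]
  rw [hlast, Fin.prod_univ_castSucc, eq_div_iff h2, mul_assoc, ← key]
  field_simp
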